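/- Fundamental theorem of calculus for contour integrals of Grassmann continuations (de Witt's formula): Let a < b be real numbers, let u, U : [a,b] → Λ be C^∞ (up to the endpoints) with U'(t) = u(t) for all t ∈ [a,b], and let ũ, Ũ be their Grassmann continuations. Let γ : [a,b] → Λ₀,ev be continuous and piecewise C¹ with π_B(γ(t)) ∈ [a,b] for all t, γ(a) = λ and γ(b) = μ, where π_B(λ) = a and π_B(μ) = b. Then ∫_γ dx ũ(x) = Ũ(μ) − Ũ(λ). -/

import Mathlib

set_option synthInstance.maxHeartbeats 1000000
set_option maxHeartbeats 2000000

noncomputable section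

open MeasureTheory

/- `Λ₀` is the real exterior (Grassmann) algebra on `L` generators and `Λ` its
complexification: we realize `Λ` as a (finite-dimensional) normed algebra identified with
`ExteriorAlgebra ℂ (Fin L → ℂ)` via an algebra isomorphism `g`, and `Λ₀` as the real
subalgebra generated by the `L` generators. -/
variable {L : ℕ} {Λ : Type} [NormedRing Λ] [NormedAlgebra ℂ Λ] [CompleteSpace Λ]

/-- The `L` Grassmann generators of `Λ`. -/
def σgen (g : ExteriorAlgebra ℂ (Fin L → ℂ) ≃ₐ[ℂ] Λ) (i : Fin L) : Λ :=
  g (ExteriorAlgebra.ι ℂ (Pi.single i 1))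

/-- `Λ₀`: the real subalgebra generated by the generators (the real Grassmann algebra). -/
def realSub (g : ExteriorAlgebra ℂ (Fin L → ℂ) ≃ₐ[ℂ] Λ) : Subalgebra ℝ Λ :=
  Algebra.adjoin ℝ (Set.range (σgen g))

/-- The even part `Λ_ev` of `Λ`. -/
def evenPart (g : ExteriorAlgebra ℂ (Fin L → ℂ) ≃ₐ[ℂ] Λ) : Submodule ℂ Λ :=
  (CliffordAlgebra.evenOdd (0 : QuadraticForm ℂ (Fin L → ℂ)) 0).map g.toLinearMap

/-- The odd part `Λ_od` of `Λ`. -/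
def oddPart (g : ExteriorAlgebra ℂ (Fin L → ℂ) ≃ₐ[ℂ] Λ) : Submodule ℂ Λ :=
  (CliffordAlgebra.evenOdd (0 : QuadraticForm ℂ (Fin L → ℂ)) 1).map g.toLinearMap

/-- `Λ₀,ev`: the even part of the real Grassmann algebra `Λ₀`, inside `Λ`. -/
def Λ0ev (g : ExteriorAlgebra ℂ (Fin L → ℂ) ≃ₐ[ℂ] Λ) : Set Λ :=
  {x | x ∈ realSub g ∧ x ∈ evenPart g}

/-- The body map `π_B : Λ → ℂ`, the algebra homomorphism annihilating all generators. -/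
def bodyMap (g : ExteriorAlgebra ℂ (Fin L → ℂ) ≃ₐ[ℂ] Λ) : Λ →ₐ[ℂ] ℂ :=
  (ExteriorAlgebra.algebraMapInv).comp g.symm.toAlgHom

/-- The soul `x_S = x − π_B(x)·1` (a nilpotent element). -/
def soul (g : ExteriorAlgebra ℂ (Fin L → ℂ) ≃ₐ[ℂ] Λ) (x : Λ) : Λ :=
  x - algebraMap ℂ Λ (bodyMap g x)

/-- The Grassmann continuation of `f : ℝ → Λ` (smooth on the set `s ⊆ ℝ`):
`f̃(x) = Σ_ℓ (1/ℓ!) f^{(ℓ)}(π_B x)·x_S^ℓ`; the sum is finite since souls are nilpotent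
(`x_S^{L+1} = 0`). -/
def gcont (g : ExteriorAlgebra ℂ (Fin L → ℂ) ≃ₐ[ℂ] Λ) (f : ℝ → Λ) (s : Set ℝ) (x : Λ) : Λ :=
  ∑ ℓ ∈ Finset.range (L + 1),
    ((ℓ.factorial : ℝ))⁻¹ • (iteratedDerivWithin ℓ f s ((bodyMap g x).re) * soul g x ^ ℓ)

/-- `γ : [a,b] → Λ` is continuous and piecewise `C¹` with (piecewise) derivative `γd`. -/
def PiecewiseC1On (γ γd : ℝ → Λ) (a b : ℝ) : Prop :=
  ContinuousOn γ (Set.Icc a b) ∧ IntervalIntegrable γd volume a b ∧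
    ∃ s : Finset ℝ, ∀ t ∈ Set.Icc a b, t ∉ s → HasDerivAt γ (γd t) t

/-- The contour integral `∫_γ dx u(x) = ∫_a^b γ'(t)·u(γ(t)) dt`. -/
def contourIntegral (γ γd : ℝ → Λ) (u : Λ → Λ) (a b : ℝ) : Λ :=
  ∫ t in a..b, γd t * u (γ t)

section Exterior

open ExteriorAlgebra

variable {R M : Type*} [CommRing R] [AddCommGroup M] [Module R M]

/-- The span of all products of at least `k` vectors in the exterior algebra. -/
def degreeGE (R M : Type*) [CommRing R] [AddCommGroup M] [Module R M] (k : ℕ) :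
    Submodule R (ExteriorAlgebra R M) :=
  ⨆ n : ℕ, LinearMap.range (ι R (M := M)) ^ (k + n)

theorem degreeGE_mul_le (k l : ℕ) : degreeGE R M k * degreeGE R M l ≤ degreeGE R M (k + l) := by
  unfold degreeGE
  rw [Submodule.iSup_mul]
  refine iSup_le fun m => ?_
  rw [Submodule.mul_iSup]
  refine iSup_le fun n => ?_
  rw [← pow_add, show k + m + (l + n) = k + l + (m + n) by ring]
  exact le_iSup (fun n : ℕ => LinearMap.range (ι R (M := M)) ^ (k + l + n)) (m + n)

theorem degreeGE_succ_le (k : ℕ) : degreeGE R M (k + 1) ≤ degreeGE R M k :=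
  iSup_le fun n => by
    rw [add_assoc]
    exact le_iSup (fun n : ℕ => LinearMap.range (ι R (M := M)) ^ (k + n)) (1 + n)

theorem sub_algebraMapInv_mem_degreeGE_one (x : ExteriorAlgebra R M) :
    x - algebraMap R _ (algebraMapInv x) ∈ degreeGE R M 1 := by
  induction x using ExteriorAlgebra.induction with
  | algebraMap r => simp [(algebraMap_leftInverse (R := R) M) r]
  | ι m =>
    have h : algebraMapInv (ι R m) = 0 := by simp [algebraMapInv]
    rw [h, map_zero, sub_zero]
    refine Submodule.mem_iSup_of_mem 0 ?_
    rw [add_zero, pow_one]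
    exact LinearMap.mem_range_self _ m
  | add x y hx hy =>
    rw [map_add, map_add, add_sub_add_comm]
    exact add_mem hx hy
  | mul x y hx hy =>
    have hxy := degreeGE_succ_le 1 (degreeGE_mul_le 1 1 (Submodule.mul_mem_mul hx hy))
    have h1 := Submodule.smul_mem _ (algebraMapInv y) hx
    have h2 := Submodule.smul_mem _ (algebraMapInv x) hy
    convert add_mem (add_mem hxy h1) h2 using 1
    simp only [map_mul, Algebra.algebraMap_eq_smul_one, smul_sub, mul_sub, sub_mul, smul_mul_assoc,
      mul_smul_comm, one_mul, mul_one, smul_smul]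
    rw [mul_comm (algebraMapInv y)]
    abel

theorem pow_mem_degreeGE {x : ExteriorAlgebra R M} (hx : x ∈ degreeGE R M 1) (n : ℕ) :
    x ^ n ∈ degreeGE R M n := by
  induction n with
  | zero =>
    refine Submodule.mem_iSup_of_mem 0 ?_
    simp
  | succ n ih => exact pow_succ x n ▸ degreeGE_mul_le n 1 (Submodule.mul_mem_mul ih hx)

theorem degreeGE_eq_bot {K V : Type*} [Field K] [AddCommGroup V] [Module K V]
    [FiniteDimensional K V] {k : ℕ} (hk : Module.finrank K V < k) : degreeGE K V k = ⊥ := by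
  refine iSup_eq_bot.2 fun n => ?_
  change ⋀[K]^(k + n) V = ⊥
  rw [← ιMulti_span_fixedDegree, Submodule.span_eq_bot]
  rintro _ ⟨v, rfl⟩
  refine AlternatingMap.map_linearDependent _ v fun hv => ?_
  have := hv.fintype_card_le_finrank
  rw [Fintype.card_fin] at this
  omega

theorem commute_of_mem_evenOdd_zero {x : ExteriorAlgebra R M}
    (hx : x ∈ CliffordAlgebra.evenOdd (0 : QuadraticForm R M) 0) (y : ExteriorAlgebra R M) :
    Commute x y := by
  have key (m₁ m₂ : M) : Commute (ι R m₁ * ι R m₂) y := by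
    induction y using ExteriorAlgebra.induction with
    | algebraMap r => exact (Algebra.commutes r _).symm
    | ι m =>
      have h1 : ι R m₂ * ι R m = -(ι R m * ι R m₂) := eq_neg_of_add_eq_zero_left (ι_add_mul_swap _ _)
      have h2 : ι R m₁ * ι R m = -(ι R m * ι R m₁) := eq_neg_of_add_eq_zero_left (ι_add_mul_swap _ _)
      rw [commute_iff_eq, mul_assoc, h1, mul_neg, ← mul_assoc, h2, neg_mul, neg_neg, mul_assoc]
    | mul a b ha hb => exact ha.mul_right hb
    | add a b ha hb => exact ha.add_right hb
  induction x, hx using CliffordAlgebra.even_induction with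
  | algebraMap r => exact Algebra.commutes r y
  | add a b _ _ ha hb => exact ha.add_left hb
  | ι_mul_ι_mul m₁ m₂ x _ ih => exact (key m₁ m₂).mul_left ih

end Exterior

section Calculus

variable {A : Type*} [NormedRing A] [NormedAlgebra ℝ A]

theorem Commute.hasDerivAt {x : ℝ → A} {x' y : A} {t : ℝ} (hx : HasDerivAt x x' t)
    (hy : ∀ᶠ r in nhds t, Commute (x r) y) : Commute x' y :=
  (hx.mul_const y).unique <| (hx.const_mul y).congr_of_eventuallyEq (hy.mono fun _ h => h)

theorem HasDerivAt.pow_of_commute {x : ℝ → A} {x' : A} {t : ℝ} (hx : HasDerivAt x x' t)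
    (hc : Commute (x t) x') (n : ℕ) :
    HasDerivAt (fun r => x r ^ n) ((n : ℝ) • (x' * x t ^ (n - 1))) t := by
  convert hx.fun_pow' n using 1
  rw [Finset.sum_congr rfl (g := fun _ => x' * x t ^ (n - 1))]
  · rw [Finset.sum_const, Finset.card_range, Nat.cast_smul_eq_nsmul]
  · intro i hi
    have hi := Finset.mem_range.1 hi
    rw [(hc.pow_left _).eq, mul_assoc, ← pow_add, Nat.pred_eq_sub_one]
    congr 2
    omega

/-- The differentiated truncated Taylor sum telescopes when the soul part is nilpotent. -/
theorem sum_taylor_telescope (D : ℕ → A) (r : ℝ) {s s' : A} (N : ℕ) (hs' : ∀ y, Commute s' y)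
    (h0 : s' * s ^ N = 0) :
    ∑ l ∈ Finset.range (N + 1), ((l.factorial : ℝ))⁻¹ •
        ((r • D (l + 1)) * s ^ l + D l * ((l : ℝ) • (s' * s ^ (l - 1))))
      = (algebraMap ℝ A r + s') *
        ∑ l ∈ Finset.range (N + 1), ((l.factorial : ℝ))⁻¹ • (D (l + 1) * s ^ l) := by
  simp only [smul_add, Finset.sum_add_distrib, add_mul]
  congr 1
  · rw [Algebra.algebraMap_eq_smul_one, smul_mul_assoc, one_mul, Finset.smul_sum]
    exact Finset.sum_congr rfl fun l _ => by rw [smul_mul_assoc, smul_comm]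
  · rw [Finset.sum_range_succ', Finset.sum_range_succ, mul_add, Finset.mul_sum]
    have hl (l : ℕ) (c : ℝ) (y : A) : s' * (c • (y * s ^ l)) = c • (y * (s' * s ^ l)) := by
      rw [mul_smul_comm, ← mul_assoc, (hs' y).eq, mul_assoc]
    rw [hl, h0]
    simp only [mul_zero, smul_zero, Nat.cast_zero, zero_smul, add_zero]
    refine Finset.sum_congr rfl fun l _ => ?_
    rw [hl, mul_smul_comm, smul_smul, Nat.add_sub_cancel, Nat.factorial_succ,
      Nat.cast_mul, mul_inv, mul_comm, ← mul_assoc, mul_inv_cancel₀ (by positivity), one_mul]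

end Calculus


set_option linter.unusedSectionVars false

theorem soul_pow_eq_zero (g : ExteriorAlgebra ℂ (Fin L → ℂ) ≃ₐ[ℂ] Λ) (x : Λ) :
    soul g x ^ (L + 1) = 0 := by
  have h := pow_mem_degreeGE (sub_algebraMapInv_mem_degreeGE_one (g.symm x)) (L + 1)
  rw [degreeGE_eq_bot (by simp), Submodule.mem_bot] at h
  apply g.symm.injective
  rw [map_pow, map_zero, ← h, soul, map_sub, AlgEquiv.commutes]
  rfl

theorem commute_of_mem_evenPart (g : ExteriorAlgebra ℂ (Fin L → ℂ) ≃ₐ[ℂ] Λ) {x : Λ}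
    (hx : x ∈ evenPart g) (y : Λ) : Commute x y := by
  obtain ⟨z, hz, rfl⟩ := hx
  have h := (commute_of_mem_evenOdd_zero hz (g.symm y)).map g
  rwa [AlgEquiv.apply_symm_apply] at h

theorem bodyMap_im_eq_zero (g : ExteriorAlgebra ℂ (Fin L → ℂ) ≃ₐ[ℂ] Λ) {x : Λ}
    (hx : x ∈ realSub g) : (bodyMap g x).im = 0 := by
  induction hx using Algebra.adjoin_induction with
  | mem x hx =>
    obtain ⟨i, rfl⟩ := hx
    simp [bodyMap, σgen, ExteriorAlgebra.algebraMapInv]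
  | algebraMap r =>
    rw [IsScalarTower.algebraMap_apply ℝ ℂ Λ, AlgHom.commutes]
    simp
  | add x y _ _ hx hy => simp [hx, hy]
  | mul x y _ _ hx hy => simp [hx, hy]

/-- The real part of the body, as a continuous real-linear map. -/
def bodyRe (g : ExteriorAlgebra ℂ (Fin L → ℂ) ≃ₐ[ℂ] Λ) : Λ →L[ℝ] ℝ :=
  Complex.reCLM.comp ((bodyMap g).toContinuousLinearMap.restrictScalars ℝ)

/-- The imaginary part of the body, as a continuous real-linear map. -/
def bodyIm (g : ExteriorAlgebra ℂ (Fin L → ℂ) ≃ₐ[ℂ] Λ) : Λ →L[ℝ] ℝ :=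
  Complex.imCLM.comp ((bodyMap g).toContinuousLinearMap.restrictScalars ℝ)

/-- The soul, as a continuous real-linear map. -/
def soulCLM (g : ExteriorAlgebra ℂ (Fin L → ℂ) ≃ₐ[ℂ] Λ) : Λ →L[ℝ] Λ :=
  (ContinuousLinearMap.id ℂ Λ -
    (bodyMap g).toContinuousLinearMap.smulRight (1 : Λ)).restrictScalars ℝ

theorem soulCLM_apply (g : ExteriorAlgebra ℂ (Fin L → ℂ) ≃ₐ[ℂ] Λ) (x : Λ) :
    soulCLM g x = soul g x := by
  rw [soul, Algebra.algebraMap_eq_smul_one]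
  rfl

theorem algebraMap_add_soul (g : ExteriorAlgebra ℂ (Fin L → ℂ) ≃ₐ[ℂ] Λ) {x : Λ}
    (hx : bodyIm g x = 0) : algebraMap ℝ Λ (bodyRe g x) + soul g x = x := by
  have h : bodyMap g x = (bodyRe g x : ℂ) := Complex.ext rfl hx
  rw [soul, h, IsScalarTower.algebraMap_apply ℝ ℂ Λ]
  exact add_sub_cancel _ _

theorem commute_soul (g : ExteriorAlgebra ℂ (Fin L → ℂ) ≃ₐ[ℂ] Λ) {x : Λ}
    (hx : ∀ y, Commute x y) (y : Λ) : Commute (soul g x) y :=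
  (hx y).sub_left (Algebra.commutes _ y)

theorem continuousOn_gcont_comp (g : ExteriorAlgebra ℂ (Fin L → ℂ) ≃ₐ[ℂ] Λ) {f : ℝ → Λ}
    {s T : Set ℝ} (hs : UniqueDiffOn ℝ s) (hf : ContDiffOn ℝ (⊤ : ℕ∞) f s) {γ : ℝ → Λ}
    (hγ : ContinuousOn γ T) (hbody : Set.MapsTo (fun t => bodyRe g (γ t)) T s) :
    ContinuousOn (fun t => gcont g f s (γ t)) T := by
  unfold gcont
  refine continuousOn_finsetSum _ fun l _ => ContinuousOn.const_smul (ContinuousOn.mul ?_ ?_) _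
  · exact (hf.continuousOn_iteratedDerivWithin (by exact_mod_cast le_top) hs).comp
      ((bodyRe g).continuous.comp_continuousOn hγ) hbody
  · simp only [← soulCLM_apply]
    exact ((soulCLM g).continuous.comp_continuousOn hγ).pow l

/-- Chain rule: along a path in `Λ₀,ev`, the continuation of `U` has derivative `γ' ũ(γ)`. -/
theorem hasDerivAt_gcont_comp (g : ExteriorAlgebra ℂ (Fin L → ℂ) ≃ₐ[ℂ] Λ) {s : Set ℝ}
    (hs : UniqueDiffOn ℝ s) {u U : ℝ → Λ} (hU : ContDiffOn ℝ (⊤ : ℕ∞) U s)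
    (hU' : ∀ t ∈ s, HasDerivWithinAt U (u t) s t) {γ : ℝ → Λ} {γ' : Λ} {t : ℝ} {T : Set ℝ}
    (hT : T ∈ nhds t) (hγ : HasDerivAt γ γ' t) (hmem : ∀ r ∈ T, γ r ∈ Λ0ev g)
    (hbody : Set.MapsTo (fun r => bodyRe g (γ r)) T s) :
    HasDerivAt (fun r => gcont g U s (γ r)) (γ' * gcont g u s (γ t)) t := by
  have hcomm : ∀ y, Commute γ' y := fun y => Commute.hasDerivAt hγ <| by
    filter_upwards [hT] with r hr using commute_of_mem_evenPart g (hmem r hr).2 y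
  have him : bodyIm g γ' = 0 :=
    ((bodyIm g).hasFDerivAt.comp_hasDerivAt t hγ).unique <|
      (hasDerivAt_const t (0 : ℝ)).congr_of_eventuallyEq <| by
        filter_upwards [hT] with r hr using bodyMap_im_eq_zero g (hmem r hr).1
  have hβ : HasDerivAt (fun r => bodyRe g (γ r)) (bodyRe g γ') t :=
    (bodyRe g).hasFDerivAt.comp_hasDerivAt t hγ
  have hσ : HasDerivAt (fun r => soul g (γ r)) (soul g γ') t := by
    simp only [← soulCLM_apply]
    exact (soulCLM g).hasFDerivAt.comp_hasDerivAt t hγ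
  have hσpow := hσ.pow_of_commute (commute_soul g hcomm _).symm
  have hβt : bodyRe g (γ t) ∈ s := hbody (mem_of_mem_nhds hT)
  have hD (l : ℕ) : HasDerivAt (fun r => iteratedDerivWithin l U s (bodyRe g (γ r)))
      (bodyRe g γ' • iteratedDerivWithin (l + 1) U s (bodyRe g (γ t))) t := by
    have h := (hU.differentiableOn_iteratedDerivWithin (m := l)
      (by exact_mod_cast ENat.natCast_lt_top l) hs _ hβt).hasDerivWithinAt
    rw [← iteratedDerivWithin_succ] at h
    exact (h.scomp t hβ.hasDerivWithinAt hbody).hasDerivAt hT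
  have hnil : soul g γ' * soul g (γ t) ^ L = 0 := by
    have h := (hσpow (L + 1)).unique <|
      (hasDerivAt_const t (0 : Λ)).congr_of_eventuallyEq <|
        .of_forall fun r => soul_pow_eq_zero g (γ r)
    exact (smul_eq_zero.1 h).resolve_left (by positivity)
  have hiter (l : ℕ) : iteratedDerivWithin l u s (bodyRe g (γ t)) =
      iteratedDerivWithin (l + 1) U s (bodyRe g (γ t)) := by
    rw [iteratedDerivWithin_succ']
    exact iteratedDerivWithin_congr (fun r hr => ((hU' r hr).derivWithin (hs r hr)).symm) hβt
  have hsum := HasDerivAt.fun_sum (u := Finset.range (L + 1)) fun l _ =>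
    ((hD l).mul (hσpow l)).const_smul ((l.factorial : ℝ))⁻¹
  have htel := sum_taylor_telescope
    (fun l => iteratedDerivWithin l U s (bodyRe g (γ t))) (bodyRe g γ') L
    (commute_soul g hcomm) hnil
  rw [algebraMap_add_soul g him] at htel
  simp only [← hiter] at htel hsum
  exact htel ▸ hsum

/-- **Fundamental theorem of calculus for contour integrals of Grassmann continuations
(de Witt's formula).**  Let `a < b`, let `u, U : [a,b] → Λ` be `C^∞` up to the endpoints with
`U' = u` on `[a,b]`, and let `ũ, Ũ` be their Grassmann continuations.  If `γ : [a,b] → Λ₀,ev`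
is continuous and piecewise `C¹`, has bodies in `[a,b]`, and `γ(a) = λ`, `γ(b) = μ` with
`π_B λ = a`, `π_B μ = b`, then `∫_γ dx ũ(x) = Ũ(μ) − Ũ(λ)`. -/
theorem contour_integral_fundamental_theorem
    (g : ExteriorAlgebra ℂ (Fin L → ℂ) ≃ₐ[ℂ] Λ)
    (a b : ℝ) (hab : a < b) (u U : ℝ → Λ)
    (hu : ContDiffOn ℝ (⊤ : ℕ∞) u (Set.Icc a b)) (hU : ContDiffOn ℝ (⊤ : ℕ∞) U (Set.Icc a b))
    (hU' : ∀ t ∈ Set.Icc a b, HasDerivWithinAt U (u t) (Set.Icc a b) t)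
    (γ γd : ℝ → Λ) (hγ : PiecewiseC1On γ γd a b)
    (hγmem : ∀ t ∈ Set.Icc a b, γ t ∈ Λ0ev g)
    (hγbody : ∀ t ∈ Set.Icc a b, (bodyMap g (γ t)).re ∈ Set.Icc a b)
    (lam mu : Λ) (hγa : γ a = lam) (hγb : γ b = mu)
    (hlam : bodyMap g lam = (a : ℂ)) (hmu : bodyMap g mu = (b : ℂ)) :
    contourIntegral γ γd (gcont g u (Set.Icc a b)) a b
      = gcont g U (Set.Icc a b) mu - gcont g U (Set.Icc a b) lam := by
  have hs := uniqueDiffOn_Icc hab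
  obtain ⟨hγc, hγi, S, hS⟩ := hγ
  subst hγa hγb
  refine integral_eq_of_hasDerivAt_off_countable_of_le
    (fun t => gcont g U (Set.Icc a b) (γ t)) _ hab.le S.countable_toSet
    (continuousOn_gcont_comp g hs hU hγc hγbody) (fun t ht => ?_) (hγi.mul_continuousOn ?_)
  · exact hasDerivAt_gcont_comp g hs hU hU' (Icc_mem_nhds ht.1.1 ht.1.2)
      (hS t (Set.Ioo_subset_Icc_self ht.1) ht.2) hγmem hγbody
  · rw [Set.uIcc_of_le hab.le]
    exact continuousOn_gcont_comp g hs hu hγc hγbody
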